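/- Let s ∈ (0,1), p ∈ [2,∞), N ≥ 2 an integer with sp ≤ N, and let f : ℝ → ℝ be an odd continuous function satisfying (f1), (f3), and additionally (f2) if sp < N or (f4) if sp = N. Then for every n ∈ ℕ there exists a continuous odd map γ_n : S^{n−1} → W_r^{s,p}(ℝ^N) (continuity with respect to ‖·‖_{s,p}) such that I(γ_n(σ)) < 0 for all σ ∈ S^{n−1}. -/

import Mathlib

open MeasureTheory Real Filter Topology Set

noncomputable section

/-- `ℝ^N` -/
abbrev RN (N : ℕ) := EuclideanSpace ℝ (Fin N)

/-- The `p`-th power of the Gagliardo seminorm `[u]_{s,p}`, as an extended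
nonnegative real number:
`[u]_{s,p}^p = ∫∫ |u x - u y|^p / |x-y|^(N+sp) dx dy`. -/
def gagE (N : ℕ) (s p : ℝ) (u : RN N → ℝ) : ENNReal :=
  ∫⁻ x : RN N, ∫⁻ y : RN N,
    ENNReal.ofReal (|u x - u y| ^ p / ‖x - y‖ ^ ((N : ℝ) + s * p))

/-- The `p`-th power of the Gagliardo seminorm, as a real number. -/
def gagP (N : ℕ) (s p : ℝ) (u : RN N → ℝ) : ℝ := (gagE N s p u).toReal

/-- Membership in the fractional Sobolev space `W^{s,p}(ℝ^N)`:
`u ∈ L^p(ℝ^N)` and `[u]_{s,p} < ∞`. -/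
def memW (N : ℕ) (s p : ℝ) (u : RN N → ℝ) : Prop :=
  AEStronglyMeasurable u volume ∧ Integrable (fun x => |u x| ^ p) volume ∧
    gagE N s p u < ⊤

/-- `‖u‖_{s,p}^p = [u]_{s,p}^p + ‖u‖_{L^p}^p`. -/
def sobNormP (N : ℕ) (s p : ℝ) (u : RN N → ℝ) : ℝ :=
  gagP N s p u + ∫ x : RN N, |u x| ^ p

/-- The norm `‖u‖_{s,p} = ([u]_{s,p}^p + ‖u‖_{L^p}^p)^(1/p)`. -/
def sobNorm (N : ℕ) (s p : ℝ) (u : RN N → ℝ) : ℝ := (sobNormP N s p u) ^ (1 / p)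

/-- `u` is radially symmetric: `u x` depends only on `‖x‖`. -/
def radial (N : ℕ) (u : RN N → ℝ) : Prop := ∀ x y : RN N, ‖x‖ = ‖y‖ → u x = u y

/-- Membership in `W_r^{s,p}(ℝ^N)`, the subspace of radial functions. -/
def memWr (N : ℕ) (s p : ℝ) (u : RN N → ℝ) : Prop := memW N s p u ∧ radial N u

/-- The primitive `F(t) = ∫_0^t f(τ) dτ`. -/
def primF (f : ℝ → ℝ) (t : ℝ) : ℝ := ∫ τ in (0:ℝ)..t, f τ

/-- The energy functional `I(u) = (1/p)‖u‖_{s,p}^p - ∫ F(u)`. -/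
def ene (N : ℕ) (s p : ℝ) (f : ℝ → ℝ) (u : RN N → ℝ) : ℝ :=
  (1 / p) * sobNormP N s p u - ∫ x : RN N, primF f (u x)

/-- The pairing `⟨(-Δ_p)^s u, φ⟩`. -/
def pairA (N : ℕ) (s p : ℝ) (u φ : RN N → ℝ) : ℝ :=
  ∫ x : RN N, ∫ y : RN N,
    |u x - u y| ^ (p - 2) * (u x - u y) * (φ x - φ y) / ‖x - y‖ ^ ((N : ℝ) + s * p)

/-- The derivative `I'(u)·φ`. -/
def enePrime (N : ℕ) (s p : ℝ) (f : ℝ → ℝ) (u φ : RN N → ℝ) : ℝ :=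
  pairA N s p u φ + (∫ x : RN N, |u x| ^ (p - 2) * u x * φ x) -
    ∫ x : RN N, f (u x) * φ x

/-- `u` is a weak solution of `(-Δ_p)^s u = -|u|^{p-2}u + f(u)` in `ℝ^N`:
for every `φ ∈ W^{s,p}(ℝ^N)`,
`⟨(-Δ_p)^s u, φ⟩ + ∫ |u|^{p-2} u φ = ∫ f(u) φ`. -/
def weakSol (N : ℕ) (s p : ℝ) (f : ℝ → ℝ) (u : RN N → ℝ) : Prop :=
  ∀ φ : RN N → ℝ, memW N s p φ →
    pairA N s p u φ + (∫ x : RN N, |u x| ^ (p - 2) * u x * φ x) =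
      ∫ x : RN N, f (u x) * φ x

/-- Hypothesis (f1): `lim_{t→0} f(t)/(|t|^{p-2} t) = 0`. -/
def hypF1 (p : ℝ) (f : ℝ → ℝ) : Prop :=
  Tendsto (fun t => f t / (|t| ^ (p - 2) * t)) (𝓝[≠] (0:ℝ)) (𝓝 0)

/-- Hypothesis (f2): `limsup_{t→+∞} f(t)/t^{p_s^*-1} ≤ 1`, where
`p_s^* = pN/(N-sp)`. -/
def hypF2 (N : ℕ) (s p : ℝ) (f : ℝ → ℝ) : Prop :=
  Filter.limsup (fun t : ℝ => ((f t / t ^ (p * N / ((N : ℝ) - s * p) - 1) : ℝ) : EReal))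
    atTop ≤ 1

/-- Hypothesis (f3): there are `μ > 0` and `q ∈ (p,∞)` with `f(t) ≥ μ t^{q-1}`
for all `t ≥ 0`. -/
def hypF3 (p : ℝ) (f : ℝ → ℝ) : Prop :=
  ∃ μ > (0:ℝ), ∃ q : ℝ, p < q ∧ ∀ t ≥ (0:ℝ), μ * t ^ (q - 1) ≤ f t

/-- Hypothesis (f4) with threshold `α₀`:
`lim_{t→+∞} f(t)/e^{α t^{N/(N-s)}} = 0` for `α > α₀` and `= +∞` for `0 < α < α₀`. -/
def hypF4 (N : ℕ) (s : ℝ) (f : ℝ → ℝ) (α₀ : ℝ) : Prop :=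
  (∀ α > α₀, Tendsto (fun t => f t / Real.exp (α * t ^ ((N : ℝ) / ((N : ℝ) - s))))
      atTop (𝓝 0)) ∧
  (∀ α : ℝ, 0 < α → α < α₀ →
    Tendsto (fun t => f t / Real.exp (α * t ^ ((N : ℝ) / ((N : ℝ) - s)))) atTop atTop)

/-- `Q_α(t) = e^{α|t|^{p'}} - ∑_{0 ≤ j < p} (α|t|^{p'})^j / j!`, with `p' = p/(p-1)`. -/
def Qfun (p α t : ℝ) : ℝ :=
  Real.exp (α * |t| ^ (p / (p - 1))) -
    ∑ j ∈ Finset.range ⌈p⌉₊, (α * |t| ^ (p / (p - 1))) ^ j / (Nat.factorial j : ℝ)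

/-- `G(t) = F(t) - |t|^p/p`, the primitive of `g(t) = -|t|^{p-2}t + f(t)`. -/
def Gfun (p : ℝ) (f : ℝ → ℝ) (t : ℝ) : ℝ := primF f t - |t| ^ p / p

/-- The best constant `C_q` of the embedding `W^{s,p}(ℝ^N) ↪ L^q(ℝ^N)`:
`C_q = inf { ([u]_{s,p}^p + ‖u‖_{L^p}^p) / ‖u‖_{L^q}^p : u ≠ 0 }`. -/
def CqConst (N : ℕ) (s p q : ℝ) : ℝ :=
  sInf {r : ℝ | ∃ u : RN N → ℝ, memW N s p u ∧ u ≠ 0 ∧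
    r = sobNormP N s p u / (∫ x : RN N, |u x| ^ q) ^ (p / q)}

/-- The best fractional Sobolev constant
`S = inf { [u]_{s,p}^p / ‖u‖_{L^{p_s^*}}^p : u ∈ D^{s,p}(ℝ^N), u ≠ 0 }`. -/
def Sconst (N : ℕ) (s p : ℝ) : ℝ :=
  sInf {r : ℝ | ∃ u : RN N → ℝ,
    Integrable (fun x => |u x| ^ (p * N / ((N : ℝ) - s * p))) volume ∧
    AEStronglyMeasurable u volume ∧ gagE N s p u < ⊤ ∧ u ≠ 0 ∧
    r = gagP N s p u /
      (∫ x : RN N, |u x| ^ (p * N / ((N : ℝ) - s * p))) ^ (p / (p * N / ((N : ℝ) - s * p)))}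

/-- The constant `μ*` in hypothesis `(f3)_gs` when `sp < N`. -/
def muStarSub (N : ℕ) (s p q : ℝ) : ℝ :=
  ((p : ℝ) ^ ((s * p - N) / (s * p)) * Sconst N s p ^ (-(N : ℝ) / (s * p)) *
      ((N : ℝ) / s) *
      (p * N / ((N : ℝ) - s * p)) ^ (((N : ℝ) - s * p) / (s * p))) ^ ((q - p) / p) *
    ((q - p) / (p * q)) ^ ((q - p) / p) * CqConst N s p q ^ (q / p)

/-- The constant `μ*` in hypothesis `(f3)_gs` when `sp = N`. -/
def muStarEq (N : ℕ) (s p q : ℝ) : ℝ :=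
  ((q - p) / (p * q)) ^ ((q - p) / p) * CqConst N s p q ^ (q / p)

/-- Hypothesis (f5): `f(t)t - pF(t) ≥ 0` for `t > 0`, and `F ≥ 0`. -/
def hypF5 (p : ℝ) (f : ℝ → ℝ) : Prop :=
  (∀ t > (0:ℝ), 0 ≤ f t * t - p * primF f t) ∧ ∀ t : ℝ, 0 ≤ primF f t

/-- The ground state level `m = inf { I(v) : v ∈ W^{s,p}(ℝ^N) \ {0}, I'(v) = 0 }`. -/
def gsLevel (N : ℕ) (s p : ℝ) (f : ℝ → ℝ) : ℝ :=
  sInf {c : ℝ | ∃ v : RN N → ℝ, memW N s p v ∧ v ≠ 0 ∧ weakSol N s p f v ∧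
    c = ene N s p f v}

/-- Continuity of a path `γ : [0,1] → W^{s,p}(ℝ^N)` with respect to `‖·‖_{s,p}`. -/
def pathCont (N : ℕ) (s p : ℝ) (γ : ℝ → RN N → ℝ) : Prop :=
  ∀ t ∈ Set.Icc (0:ℝ) 1, ∀ ε > (0:ℝ), ∃ δ > (0:ℝ), ∀ t' ∈ Set.Icc (0:ℝ) 1,
    |t - t'| < δ → sobNorm N s p (fun x => γ t x - γ t' x) < ε

/-- The mountain pass level `b = inf_{γ ∈ Γ} max_{t ∈ [0,1]} I(γ(t))`, where
`Γ = { γ : [0,1] → W^{s,p}(ℝ^N) continuous : γ(0) = 0, I(γ(1)) < 0 }`. -/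
def mpLevel (N : ℕ) (s p : ℝ) (f : ℝ → ℝ) : ℝ :=
  sInf {c : ℝ | ∃ γ : ℝ → RN N → ℝ, (∀ t ∈ Set.Icc (0:ℝ) 1, memW N s p (γ t)) ∧
    pathCont N s p γ ∧ γ 0 = 0 ∧ ene N s p f (γ 1) < 0 ∧
    c = sSup ((fun t => ene N s p f (γ t)) '' Set.Icc (0:ℝ) 1)}

/-- The Pohožaev set
`P = { u ∈ W^{s,p}(ℝ^N) \ {0} : ((N-sp)/p)[u]_{s,p}^p = N ∫ G(u) }`. -/
def pohSet (N : ℕ) (s p : ℝ) (f : ℝ → ℝ) : Set (RN N → ℝ) :=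
  {u | memW N s p u ∧ u ≠ 0 ∧
    (((N : ℝ) - s * p) / p) * gagP N s p u = N * ∫ x : RN N, Gfun p f (u x)}

/-- `p̃ = inf { I(u) : u ∈ P }`. -/
def pohLevel (N : ℕ) (s p : ℝ) (f : ℝ → ℝ) : ℝ :=
  sInf {c : ℝ | ∃ u ∈ pohSet N s p f, c = ene N s p f u}

/-- The constraint set `M = { u ∈ W^{s,p}(ℝ^N) \ {0} : ∫ G(u) = 1 }`. -/
def Mset (N : ℕ) (s p : ℝ) (f : ℝ → ℝ) : Set (RN N → ℝ) :=
  {u | memW N s p u ∧ u ≠ 0 ∧ (∫ x : RN N, Gfun p f (u x)) = 1}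

/-- `D = inf { (1/p)[u]_{s,p}^p : u ∈ M }`. -/
def Dconst (N : ℕ) (s p : ℝ) (f : ℝ → ℝ) : ℝ :=
  sInf {c : ℝ | ∃ u ∈ Mset N s p f, c = (1 / p) * gagP N s p u}

/-- `J'(u)·φ = ∫ (f(u) - |u|^{p-2}u) φ`. -/
def Jprime (N : ℕ) (s p : ℝ) (f : ℝ → ℝ) (u φ : RN N → ℝ) : ℝ :=
  ∫ x : RN N, (f (u x) - |u x| ^ (p - 2) * u x) * φ x

/-- `(u_j)` is a `(PS)_c` sequence in `W_r^{s,p}(ℝ^N)` for `I`: `I(u_j) → c` and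
`sup { |I'(u_j)·φ| : φ ∈ W_r^{s,p}, ‖φ‖_{s,p} ≤ 1 } → 0`. -/
def PSseq (N : ℕ) (s p : ℝ) (f : ℝ → ℝ) (c : ℝ) (u : ℕ → RN N → ℝ) : Prop :=
  (∀ j, memWr N s p (u j)) ∧
  Tendsto (fun j => ene N s p f (u j)) atTop (𝓝 c) ∧
  (∀ δ > (0:ℝ), ∀ᶠ j in atTop, ∀ φ : RN N → ℝ, memWr N s p φ →
    sobNorm N s p φ ≤ 1 → |enePrime N s p f (u j) φ| ≤ δ)

/-- radial tent functions with disjoint supports -/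
def tent (N : ℕ) (i : ℕ) (x : RN N) : ℝ := max 0 (1 / 2 - |‖x‖ - ((i : ℝ) + 1)|)

/-- linear combination of tents -/
def comb (N n : ℕ) (τ : EuclideanSpace ℝ (Fin n)) (x : RN N) : ℝ :=
  ∑ i : Fin n, τ i * tent N i x

/-- radial kernel profile -/
def kerH (N : ℕ) (s p : ℝ) (r : ℝ) : ℝ := (min 1 r) ^ p / r ^ ((N : ℝ) + s * p)

lemma tent_nonneg (N i : ℕ) (x : RN N) : 0 ≤ tent N i x := le_max_left _ _

lemma tent_le_one (N i : ℕ) (x : RN N) : tent N i x ≤ 1 := by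
  unfold tent
  apply max_le (by norm_num)
  have := abs_nonneg (‖x‖ - ((i : ℝ) + 1))
  linarith

lemma tent_lip (N i : ℕ) (x y : RN N) : |tent N i x - tent N i y| ≤ ‖x - y‖ := by
  unfold tent
  rw [max_comm 0, max_comm 0]
  refine (abs_max_sub_max_le_abs _ _ _).trans ?_ |>.trans (abs_norm_sub_norm_le x y)
  have h := abs_abs_sub_abs_le (‖y‖ - ((i : ℝ) + 1)) (‖x‖ - ((i : ℝ) + 1))
  rw [show (1 / 2 - |‖x‖ - ((i : ℝ) + 1)|) - (1 / 2 - |‖y‖ - ((i : ℝ) + 1)|)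
    = |‖y‖ - ((i : ℝ) + 1)| - |‖x‖ - ((i : ℝ) + 1)| by ring]
  refine h.trans (le_of_eq ?_)
  rw [abs_sub_comm]
  congr 1
  ring

lemma tent_diff_le (N i : ℕ) (x y : RN N) : |tent N i x - tent N i y| ≤ min 1 ‖x - y‖ := by
  refine le_min ?_ (tent_lip N i x y)
  rw [abs_le]
  have h1 := tent_nonneg N i x
  have h2 := tent_nonneg N i y
  have h3 := tent_le_one N i x
  have h4 := tent_le_one N i y
  constructor <;> linarith

lemma tent_continuous (N i : ℕ) : Continuous (tent N i) := by
  unfold tent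
  fun_prop

lemma tent_zero (N i n : ℕ) (hi : i < n) (x : RN N) (hx : x ∉ Metric.closedBall (0 : RN N) (n + 1)) :
    tent N i x = 0 := by
  unfold tent
  rw [Metric.mem_closedBall, dist_zero_right, not_le] at hx
  have : (i : ℝ) + 1 ≤ n := by exact_mod_cast hi
  apply max_eq_left
  rw [abs_of_nonneg (by linarith)]
  linarith

lemma tent_zero' (N i j : ℕ) (hij : j ≠ i) (x : RN N) (hx : |‖x‖ - ((i : ℝ) + 1)| < 1 / 4) :
    tent N j x = 0 := by
  unfold tent
  apply max_eq_left
  have h1 : (1 : ℝ) ≤ |(j : ℝ) - i| := by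
    have : (1 : ℤ) ≤ |(j : ℤ) - i| := Int.one_le_abs (by omega)
    exact_mod_cast this
  have h2 : |(j : ℝ) - i| ≤ |‖x‖ - ((i : ℝ) + 1)| + |‖x‖ - ((j : ℝ) + 1)| := by
    rw [show (j : ℝ) - i = (‖x‖ - ((i : ℝ) + 1)) - (‖x‖ - ((j : ℝ) + 1)) by ring]
    exact abs_sub _ _
  linarith

lemma abs_coord_le (n : ℕ) (τ : EuclideanSpace ℝ (Fin n)) (i : Fin n) : |τ i| ≤ ‖τ‖ := by
  simpa using PiLp.norm_apply_le τ i

lemma comb_continuous (N n : ℕ) (τ : EuclideanSpace ℝ (Fin n)) : Continuous (comb N n τ) := by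
  unfold comb
  refine continuous_finsetSum _ fun i _ => continuous_const.mul (tent_continuous N i)

lemma comb_zero (N n : ℕ) (τ : EuclideanSpace ℝ (Fin n)) (x : RN N)
    (hx : x ∉ Metric.closedBall (0 : RN N) (n + 1)) : comb N n τ x = 0 := by
  unfold comb
  refine Finset.sum_eq_zero fun i _ => ?_
  rw [tent_zero N i n i.2 x hx, mul_zero]

lemma comb_supp (N n : ℕ) (τ : EuclideanSpace ℝ (Fin n)) : HasCompactSupport (comb N n τ) :=
  HasCompactSupport.intro (isCompact_closedBall _ _) fun x hx => comb_zero N n τ x hx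

lemma comb_sub (N n : ℕ) (τ τ' : EuclideanSpace ℝ (Fin n)) :
    comb N n τ - comb N n τ' = comb N n (τ - τ') := by
  ext x
  simp only [comb, Pi.sub_apply, PiLp.sub_apply, ← Finset.sum_sub_distrib, sub_mul]

lemma comb_neg (N n : ℕ) (τ : EuclideanSpace ℝ (Fin n)) :
    comb N n (-τ) = -comb N n τ := by
  ext x
  simp [comb]

lemma comb_abs_le (N n : ℕ) (τ : EuclideanSpace ℝ (Fin n)) (x : RN N) :
    |comb N n τ x| ≤ n * ‖τ‖ := by
  unfold comb
  refine (Finset.abs_sum_le_sum_abs _ _).trans ?_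
  have : ∀ i ∈ (Finset.univ : Finset (Fin n)), |τ i * tent N i x| ≤ ‖τ‖ := by
    intro i _
    rw [abs_mul, abs_of_nonneg (tent_nonneg N i x)]
    have h1 := abs_coord_le n τ i
    have h2 := tent_le_one N i x
    have h3 := tent_nonneg N i x
    nlinarith [abs_nonneg (τ i)]
  simpa using Finset.sum_le_sum this

lemma comb_diff_le (N n : ℕ) (τ : EuclideanSpace ℝ (Fin n)) (x y : RN N) :
    |comb N n τ x - comb N n τ y| ≤ (n * ‖τ‖) * min 1 ‖x - y‖ := by
  unfold comb
  rw [← Finset.sum_sub_distrib]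
  refine (Finset.abs_sum_le_sum_abs _ _).trans ?_
  have : ∀ i ∈ (Finset.univ : Finset (Fin n)),
      |τ i * tent N i x - τ i * tent N i y| ≤ ‖τ‖ * min 1 ‖x - y‖ := by
    intro i _
    rw [← mul_sub, abs_mul]
    exact mul_le_mul (abs_coord_le n τ i) (tent_diff_le N i x y) (abs_nonneg _) (norm_nonneg _)
  have h := Finset.sum_le_sum this
  simp only [Finset.sum_const, Finset.card_univ, Fintype.card_fin, nsmul_eq_mul] at h
  rw [mul_assoc]
  exact h

lemma kerH_nonneg (N : ℕ) (s p r : ℝ) (hr : 0 ≤ r) : 0 ≤ kerH N s p r := by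
  unfold kerH
  positivity

lemma kerH_integrable (N : ℕ) (s p : ℝ) (hN : 2 ≤ N) (hs : s ∈ Set.Ioo (0:ℝ) 1) (hp : 2 ≤ p) :
    Integrable (fun z : RN N => kerH N s p ‖z‖) volume := by
  have : Nonempty (Fin N) := ⟨⟨0, by omega⟩⟩
  have : Nontrivial (RN N) := inferInstance
  rw [integrable_fun_norm_addHaar (volume : Measure (RN N)) (f := kerH N s p)]
  have hd : Module.finrank ℝ (RN N) = N := by simp
  rw [hd]
  have hsp : 0 < s * p := mul_pos hs.1 (by linarith)
  rw [← Ioc_union_Ioi_eq_Ioi (zero_le_one (α := ℝ))]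
  have key : ∀ y : ℝ, 0 < y → y ^ (N - 1) = y ^ ((N : ℝ) - 1) := by
    intro y hy
    rw [← Real.rpow_natCast, Nat.cast_sub (by omega), Nat.cast_one]
  refine IntegrableOn.union ?_ ?_
  · have h : IntegrableOn (fun y : ℝ => y ^ (p - s * p - 1)) (Ioc 0 1) := by
      rw [← intervalIntegrable_iff_integrableOn_Ioc_of_le zero_le_one]
      apply intervalIntegral.intervalIntegrable_rpow'
      nlinarith [hs.2]
    refine h.congr_fun ?_ measurableSet_Ioc
    intro y hy
    simp only [smul_eq_mul, kerH]
    rw [key y hy.1, min_eq_right hy.2, mul_div_assoc', ← Real.rpow_add hy.1, ← Real.rpow_sub hy.1]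
    congr 1
    ring
  · have h : IntegrableOn (fun y : ℝ => y ^ (- (s * p) - 1)) (Ioi 1) :=
      integrableOn_Ioi_rpow_of_lt (by linarith) one_pos
    refine h.congr_fun ?_ measurableSet_Ioi
    intro y hy
    have hy' : (1 : ℝ) < y := hy
    have hy0 : 0 < y := by linarith
    simp only [smul_eq_mul, kerH]
    rw [key y hy0, min_eq_left hy'.le, mul_div_assoc', Real.one_rpow, mul_one,
      ← Real.rpow_sub hy0]
    congr 1
    ring

lemma kerH_measurable (N : ℕ) (s p : ℝ) :
    Measurable (fun z : RN N => ENNReal.ofReal (kerH N s p ‖z‖)) := by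
  unfold kerH
  fun_prop

/-- uniform Gagliardo bound -/
lemma gagE_bound (N n : ℕ) (s p : ℝ) (hN : 2 ≤ N) (hs : s ∈ Set.Ioo (0:ℝ) 1) (hp : 2 ≤ p) :
    ∃ K : ℝ, 0 ≤ K ∧ ∀ τ : EuclideanSpace ℝ (Fin n),
      gagE N s p (comb N n τ) ≤ ENNReal.ofReal (K * ‖τ‖ ^ p) := by
  set B : Set (RN N) := Metric.closedBall (0 : RN N) (n + 1) with hB
  have hBm : MeasurableSet B := measurableSet_closedBall
  set h : RN N → ENNReal := fun z => ENNReal.ofReal (kerH N s p ‖z‖) with hh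
  have hm : Measurable h := kerH_measurable N s p
  have hfin : ∫⁻ z, h z < ⊤ := by
    have := (kerH_integrable N s p hN hs hp).2
    rwa [hasFiniteIntegral_iff_ofReal
      (Filter.Eventually.of_forall fun z => kerH_nonneg N s p _ (norm_nonneg z))] at this
  have hBfin : volume B < ⊤ := measure_closedBall_lt_top
  set K0 : ENNReal := 2 * (volume B * ∫⁻ z, h z) with hK0
  have hK0fin : K0 ≠ ⊤ :=
    ENNReal.mul_ne_top (by norm_num) (ENNReal.mul_ne_top hBfin.ne hfin.ne)
  have hind : Measurable (B.indicator (fun _ => (1 : ENNReal))) := measurable_const.indicator hBm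
  have I1 : ∫⁻ x : RN N, ∫⁻ y : RN N, B.indicator (fun _ => (1 : ENNReal)) x * h (x - y)
      = volume B * ∫⁻ z, h z := by
    have : ∀ x : RN N, ∫⁻ y : RN N, B.indicator (fun _ => (1 : ENNReal)) x * h (x - y)
        = B.indicator (fun _ => (1 : ENNReal)) x * ∫⁻ z, h z := by
      intro x
      rw [lintegral_const_mul _ (by fun_prop), lintegral_sub_left_eq_self]
    simp_rw [this]
    rw [lintegral_mul_const _ hind, lintegral_indicator_const hBm, one_mul]
  have I2 : ∫⁻ x : RN N, ∫⁻ y : RN N, B.indicator (fun _ => (1 : ENNReal)) y * h (x - y)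
      = volume B * ∫⁻ z, h z := by
    rw [lintegral_lintegral_swap (by
      apply Measurable.aemeasurable
      exact (hind.comp measurable_snd).mul (hm.comp (measurable_fst.sub measurable_snd)))]
    have : ∀ y : RN N, ∫⁻ x : RN N, B.indicator (fun _ => (1 : ENNReal)) y * h (x - y)
        = B.indicator (fun _ => (1 : ENNReal)) y * ∫⁻ z, h z := by
      intro x
      rw [lintegral_const_mul _ (by fun_prop), lintegral_sub_right_eq_self]
    simp_rw [this]
    rw [lintegral_mul_const _ hind, lintegral_indicator_const hBm, one_mul]
  refine ⟨K0.toReal * (n : ℝ) ^ p, by positivity, fun τ => ?_⟩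
  set c : ENNReal := ENNReal.ofReal ((n * ‖τ‖) ^ p) with hc
  have hpt : ∀ x y : RN N,
      ENNReal.ofReal (|comb N n τ x - comb N n τ y| ^ p / ‖x - y‖ ^ ((N : ℝ) + s * p)) ≤
      c * (B.indicator (fun _ => (1 : ENNReal)) x * h (x - y)
        + B.indicator (fun _ => (1 : ENNReal)) y * h (x - y)) := by
    intro x y
    by_cases hxy : x ∈ B ∨ y ∈ B
    · have h1 : ENNReal.ofReal (|comb N n τ x - comb N n τ y| ^ p / ‖x - y‖ ^ ((N : ℝ) + s * p))
          ≤ c * h (x - y) := by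
        rw [hc, hh, ← ENNReal.ofReal_mul (by positivity)]
        apply ENNReal.ofReal_le_ofReal
        unfold kerH
        rw [mul_div_assoc', ← Real.mul_rpow (by positivity) (by positivity)]
        gcongr
        exact comb_diff_le N n τ x y
      refine h1.trans ?_
      gcongr
      rcases hxy with hx | hy
      · rw [Set.indicator_of_mem hx, one_mul]
        exact le_self_add
      · rw [Set.indicator_of_mem hy, one_mul]
        exact le_add_self
    · push Not at hxy
      rw [comb_zero N n τ x hxy.1, comb_zero N n τ y hxy.2]
      simp [Real.zero_rpow (show p ≠ 0 by linarith)]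
  calc gagE N s p (comb N n τ)
      ≤ ∫⁻ x : RN N, ∫⁻ y : RN N, c * (B.indicator (fun _ => (1 : ENNReal)) x * h (x - y)
        + B.indicator (fun _ => (1 : ENNReal)) y * h (x - y)) :=
        lintegral_mono fun x => lintegral_mono fun y => hpt x y
    _ = c * K0 := by
        have e1 : ∀ x : RN N, ∫⁻ y : RN N, c * (B.indicator (fun _ => (1 : ENNReal)) x * h (x - y)
            + B.indicator (fun _ => (1 : ENNReal)) y * h (x - y))
            = c * ((∫⁻ y : RN N, B.indicator (fun _ => (1 : ENNReal)) x * h (x - y))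
            + ∫⁻ y : RN N, B.indicator (fun _ => (1 : ENNReal)) y * h (x - y)) := by
          intro x
          rw [lintegral_const_mul' _ _ ENNReal.ofReal_ne_top, lintegral_add_left (by fun_prop)]
        simp_rw [e1]
        rw [lintegral_const_mul' _ _ ENNReal.ofReal_ne_top, lintegral_add_left, I1, I2, hK0,
          two_mul]
        apply Measurable.lintegral_prod_right'
          (f := fun z : RN N × RN N => B.indicator (fun _ => (1 : ENNReal)) z.1 * h (z.1 - z.2))
        exact (hind.comp measurable_fst).mul (hm.comp (measurable_fst.sub measurable_snd))
    _ = ENNReal.ofReal (K0.toReal * (n : ℝ) ^ p * ‖τ‖ ^ p) := by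
        rw [mul_assoc, ← Real.mul_rpow (by positivity) (by positivity),
          ENNReal.ofReal_mul (by positivity), ENNReal.ofReal_toReal hK0fin, mul_comm]

lemma comb_pow_integrable (N n : ℕ) (p : ℝ) (hp : 2 ≤ p) (τ : EuclideanSpace ℝ (Fin n)) :
    Integrable (fun x => |comb N n τ x| ^ p) volume := by
  apply Continuous.integrable_of_hasCompactSupport
  · exact (comb_continuous N n τ).abs.rpow_const fun _ => Or.inr (by linarith)
  · exact (comb_supp N n τ).comp_left (g := fun t : ℝ => |t| ^ p)
      (by simp [Real.zero_rpow (show p ≠ 0 by linarith)])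

lemma comb_pow_bound (N n : ℕ) (p : ℝ) (hp : 2 ≤ p) (τ : EuclideanSpace ℝ (Fin n)) :
    ∫ x : RN N, |comb N n τ x| ^ p ≤
      (volume.real (Metric.closedBall (0 : RN N) (n + 1)) * (n : ℝ) ^ p) * ‖τ‖ ^ p := by
  set B : Set (RN N) := Metric.closedBall (0 : RN N) (n + 1) with hB
  have hBm : MeasurableSet B := measurableSet_closedBall
  have hz : ∀ x, x ∉ B → |comb N n τ x| ^ p = 0 := by
    intro x hx
    rw [comb_zero N n τ x hx, abs_zero, Real.zero_rpow (by linarith)]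
  rw [← setIntegral_eq_integral_of_forall_compl_eq_zero hz]
  have : ∫ x in B, |comb N n τ x| ^ p ≤ ∫ x in B, (n * ‖τ‖) ^ p := by
    apply setIntegral_mono_on (comb_pow_integrable N n p hp τ).integrableOn
      (integrableOn_const (hs := measure_closedBall_lt_top.ne)) hBm
    intro x _
    exact Real.rpow_le_rpow (abs_nonneg _) (comb_abs_le N n τ x) (by linarith)
  refine this.trans (le_of_eq ?_)
  rw [setIntegral_const, smul_eq_mul, Real.mul_rpow (by positivity) (by positivity), mul_assoc]

lemma sob_bound (N n : ℕ) (s p : ℝ) (hN : 2 ≤ N) (hs : s ∈ Set.Ioo (0:ℝ) 1) (hp : 2 ≤ p) :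
    ∃ C : ℝ, 0 < C ∧ ∀ τ : EuclideanSpace ℝ (Fin n),
      memWr N s p (comb N n τ) ∧ 0 ≤ sobNormP N s p (comb N n τ) ∧
      sobNormP N s p (comb N n τ) ≤ C * ‖τ‖ ^ p := by
  obtain ⟨K, hK, hKb⟩ := gagE_bound N n s p hN hs hp
  refine ⟨K + volume.real (Metric.closedBall (0 : RN N) (n + 1)) * (n : ℝ) ^ p + 1,
    by positivity, fun τ => ⟨⟨⟨(comb_continuous N n τ).aestronglyMeasurable,
      comb_pow_integrable N n p hp τ, (hKb τ).trans_lt ENNReal.ofReal_lt_top⟩, ?_⟩, ?_, ?_⟩⟩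
  · intro x y hxy
    simp only [comb, tent, hxy]
  · exact add_nonneg ENNReal.toReal_nonneg (integral_nonneg fun x => by positivity)
  · unfold sobNormP gagP
    have h1 : (gagE N s p (comb N n τ)).toReal ≤ K * ‖τ‖ ^ p :=
      ENNReal.toReal_le_of_le_ofReal (by positivity) (hKb τ)
    have h2 := comb_pow_bound N n p hp τ
    have h3 : 0 ≤ ‖τ‖ ^ p := by positivity
    linarith

lemma primF_bound (f : ℝ → ℝ) (hfc : Continuous f) (hodd : ∀ t : ℝ, f (-t) = -f t)
    (μ q : ℝ) (hq : 2 < q) (h : ∀ t ≥ (0:ℝ), μ * t ^ (q - 1) ≤ f t) (t : ℝ) :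
    μ / q * |t| ^ q ≤ primF f t := by
  have pos : ∀ t : ℝ, 0 ≤ t → μ / q * t ^ q ≤ primF f t := by
    intro t ht
    have h1 : ∫ τ in (0:ℝ)..t, μ * τ ^ (q - 1) ≤ primF f t := by
      apply intervalIntegral.integral_mono_on ht
      · exact (intervalIntegral.intervalIntegrable_rpow' (by linarith)).const_mul _
      · exact hfc.intervalIntegrable _ _
      · intro x hx
        exact h x hx.1
    rw [intervalIntegral.integral_const_mul, integral_rpow (Or.inl (by linarith)),
      sub_add_cancel, Real.zero_rpow (by linarith), sub_zero] at h1
    calc μ / q * t ^ q = μ * (t ^ q / q) := by ring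
      _ ≤ _ := h1
  rcases le_total 0 t with ht | ht
  · rw [abs_of_nonneg ht]
    exact pos t ht
  · rw [abs_of_nonpos ht]
    have h2 : primF f (-t) = primF f t := by
      unfold primF
      have := intervalIntegral.integral_comp_neg (a := 0) (b := t) f
      simp only [hodd, neg_zero, intervalIntegral.integral_neg] at this
      rw [intervalIntegral.integral_symm, ← this, neg_neg]
    rw [← h2]
    exact pos (-t) (by linarith)

lemma ene_lower (N n : ℕ) (f : ℝ → ℝ) (hN : 2 ≤ N) (hn : 0 < n) (hfc : Continuous f)
    (hodd : ∀ t : ℝ, f (-t) = -f t)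
    (μ q : ℝ) (hμ : 0 < μ) (hq : 2 < q) (h : ∀ t ≥ (0:ℝ), μ * t ^ (q - 1) ≤ f t) :
    ∃ c : ℝ, 0 < c ∧ ∀ τ : EuclideanSpace ℝ (Fin n),
      c * ‖τ‖ ^ q ≤ ∫ x : RN N, primF f (comb N n τ x) := by
  have : Nonempty (Fin N) := ⟨⟨0, by omega⟩⟩
  have : Nontrivial (RN N) := inferInstance
  have : Nonempty (Fin n) := ⟨⟨0, hn⟩⟩
  let A : Fin n → Set (RN N) := fun i => {x | |‖x‖ - ((i : ℝ) + 1)| < 1 / 4}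
  have hAo : ∀ i, IsOpen (A i) := fun i => isOpen_lt (by fun_prop) continuous_const
  have hAs : ∀ i, A i ⊆ Metric.closedBall (0 : RN N) (n + 1) := by
    intro i x hx
    by_contra hcon
    have hx' : |‖x‖ - (((i : ℕ) : ℝ) + 1)| < 1 / 4 := hx
    rw [Metric.mem_closedBall, dist_zero_right, not_le] at hcon
    have : ((i : ℕ) : ℝ) + 1 ≤ n := by exact_mod_cast i.2
    rw [abs_lt] at hx'
    linarith
  have hAfin : ∀ i, volume (A i) ≠ ⊤ := fun i =>
    ((measure_mono (hAs i)).trans_lt measure_closedBall_lt_top).ne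
  have hApos : ∀ i, 0 < volume.real (A i) := by
    intro i
    obtain ⟨x, hx⟩ := exists_norm_eq (RN N) (show (0 : ℝ) ≤ (i : ℝ) + 1 by positivity)
    refine ENNReal.toReal_pos ((hAo i).measure_pos volume ⟨x, ?_⟩).ne' (hAfin i)
    change |‖x‖ - (((i : ℕ) : ℝ) + 1)| < 1 / 4
    rw [hx]
    norm_num
  obtain ⟨i0, hi0⟩ := Finite.exists_min fun i => volume.real (A i)
  have hn' : (0 : ℝ) < n := by exact_mod_cast hn
  have hFcont : Continuous (primF f) :=
    intervalIntegral.continuous_primitive (fun a b => hfc.intervalIntegrable a b) 0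
  refine ⟨μ / q * (1 / (4 * n)) ^ q * volume.real (A i0), by have := hApos i0; positivity,
    fun τ => ?_⟩
  have hint : Integrable (fun x => primF f (comb N n τ x)) := by
    apply Continuous.integrable_of_hasCompactSupport
    · exact hFcont.comp (comb_continuous N n τ)
    · exact (comb_supp N n τ).comp_left (g := primF f) (by simp [primF])
  have hnn : ∀ t, 0 ≤ primF f t := fun t =>
    le_trans (by positivity) (primF_bound f hfc hodd μ q hq h t)
  -- a large coordinate
  obtain ⟨i, hi⟩ : ∃ i, ‖τ‖ ≤ n * |τ i| := by
    by_contra hcon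
    push Not at hcon
    have h1 : ‖τ‖ ≤ ∑ i, |τ i| := by
      rw [EuclideanSpace.norm_eq]
      refine Real.sqrt_le_iff.2 ⟨Finset.sum_nonneg fun i _ => abs_nonneg _, ?_⟩
      simp only [Real.norm_eq_abs]
      exact Finset.sum_sq_le_sq_sum_of_nonneg fun i _ => abs_nonneg _
    have h2 : ∑ i : Fin n, |τ i| * n < ∑ i : Fin n, ‖τ‖ := by
      apply Finset.sum_lt_sum_of_nonempty Finset.univ_nonempty
      intro i _
      rw [mul_comm]
      exact hcon i
    rw [← Finset.sum_mul] at h2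
    simp only [Finset.sum_const, Finset.card_univ, Fintype.card_fin, nsmul_eq_mul] at h2
    nlinarith
  have hval : ∀ x ∈ A i, μ / q * (1 / (4 * n)) ^ q * ‖τ‖ ^ q ≤ primF f (comb N n τ x) := by
    intro x hx
    have hx' : |‖x‖ - (((i : ℕ) : ℝ) + 1)| < 1 / 4 := hx
    refine le_trans ?_ (primF_bound f hfc hodd μ q hq h _)
    rw [mul_assoc, ← Real.mul_rpow (by positivity) (by positivity)]
    have hcomb : comb N n τ x = τ i * tent N i x := by
      unfold comb
      apply Finset.sum_eq_single i
      · intro j _ hj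
        rw [tent_zero' N i j (fun hh => hj (Fin.ext hh)) x hx', mul_zero]
      · simp
    have ht : 1 / 4 ≤ tent N i x := le_trans (by linarith) (le_max_right _ _)
    gcongr
    rw [hcomb, abs_mul, abs_of_nonneg (tent_nonneg N i x)]
    calc 1 / (4 * (n : ℝ)) * ‖τ‖ ≤ 1 / (4 * (n : ℝ)) * (n * |τ i|) := by gcongr
      _ = |τ i| * (1 / 4) := by field_simp
      _ ≤ _ := by gcongr
  calc μ / q * (1 / (4 * n)) ^ q * volume.real (A i0) * ‖τ‖ ^ q
      = μ / q * (1 / (4 * n)) ^ q * ‖τ‖ ^ q * volume.real (A i0) := by ring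
    _ ≤ μ / q * (1 / (4 * n)) ^ q * ‖τ‖ ^ q * volume.real (A i) := by
        exact mul_le_mul_of_nonneg_left (hi0 i) (by positivity)
    _ ≤ ∫ x in A i, primF f (comb N n τ x) :=
        setIntegral_ge_of_const_le_real (hAo i).measurableSet (hAfin i) hval hint.integrableOn
    _ ≤ _ := setIntegral_le_integral hint (Filter.Eventually.of_forall fun x => hnn _)

theorem exists_odd_map_sphere_negative_energy (N : ℕ) (s p : ℝ) (f : ℝ → ℝ)
    (hN : 2 ≤ N) (hs : s ∈ Set.Ioo (0:ℝ) 1) (hp : 2 ≤ p)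
    (hsp : s * p ≤ N)
    (hfc : Continuous f) (hodd : ∀ t : ℝ, f (-t) = -f t)
    (hf1 : hypF1 p f) (hf3 : hypF3 p f)
    (hf2 : s * p < N → hypF2 N s p f)
    (hf4 : s * p = N → ∃ α₀ > (0:ℝ), hypF4 N s f α₀) :
    ∀ n : ℕ, ∃ γ : EuclideanSpace ℝ (Fin n) → RN N → ℝ,
      (∀ σ : EuclideanSpace ℝ (Fin n), ‖σ‖ = 1 → memWr N s p (γ σ)) ∧
      (∀ σ : EuclideanSpace ℝ (Fin n), ‖σ‖ = 1 → γ (-σ) = -(γ σ)) ∧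
      (∀ σ : EuclideanSpace ℝ (Fin n), ‖σ‖ = 1 → ∀ ε > (0:ℝ), ∃ δ > (0:ℝ),
        ∀ σ' : EuclideanSpace ℝ (Fin n), ‖σ'‖ = 1 → ‖σ - σ'‖ < δ →
          sobNorm N s p (γ σ - γ σ') < ε) ∧
      (∀ σ : EuclideanSpace ℝ (Fin n), ‖σ‖ = 1 → ene N s p f (γ σ) < 0) := by
  intro n
  rcases Nat.eq_zero_or_pos n with hn | hn
  · subst hn
    have hno : ∀ σ : EuclideanSpace ℝ (Fin 0), ‖σ‖ = 1 → False := by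
      intro σ h
      rw [Subsingleton.elim σ 0, norm_zero] at h
      exact zero_ne_one h
    exact ⟨fun _ _ => 0, fun σ h => (hno σ h).elim, fun σ h => (hno σ h).elim,
      fun σ h => (hno σ h).elim, fun σ h => (hno σ h).elim⟩
  obtain ⟨μ, hμ, q, hpq, hfq⟩ := hf3
  obtain ⟨C, hC, hCb⟩ := sob_bound N n s p hN hs hp
  obtain ⟨c, hc, hcb⟩ := ene_lower N n f hN hn hfc hodd μ q hμ (by linarith) hfq
  obtain ⟨R, hR0, hR⟩ : ∃ R : ℝ, 0 < R ∧ 1 / p * C < c * R ^ (q - p) := by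
    have ht : Tendsto (fun R : ℝ => c * R ^ (q - p)) atTop atTop :=
      (tendsto_rpow_atTop (by linarith)).const_mul_atTop hc
    obtain ⟨R, h1, h2⟩ := ((eventually_gt_atTop 0).and (ht.eventually_gt_atTop (1 / p * C))).exists
    exact ⟨R, h1, h2⟩
  refine ⟨fun σ => comb N n (R • σ), fun σ _ => (hCb _).1, fun σ _ => ?_, fun σ _ ε hε => ?_,
    fun σ hσ => ?_⟩
  · change comb N n (R • (-σ)) = -comb N n (R • σ)
    rw [smul_neg, comb_neg]
  · have hp0 : 0 < p := by linarith
    refine ⟨ε / (C ^ (1 / p) * R), by positivity, fun σ' _ hd => ?_⟩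
    rw [comb_sub, ← smul_sub]
    unfold sobNorm
    have h1 := (hCb (R • (σ - σ'))).2
    calc _ ≤ (C * ‖R • (σ - σ')‖ ^ p) ^ (1 / p) :=
          Real.rpow_le_rpow h1.1 h1.2 (by positivity)
      _ = C ^ (1 / p) * R * ‖σ - σ'‖ := by
          rw [Real.mul_rpow hC.le (by positivity), ← Real.rpow_mul (norm_nonneg _),
            mul_one_div_cancel hp0.ne', Real.rpow_one, norm_smul, Real.norm_of_nonneg hR0.le,
            mul_assoc]
      _ < ε := by
          rw [lt_div_iff₀ (by positivity)] at hd
          linarith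
  · have hnorm : ‖R • σ‖ = R := by rw [norm_smul, hσ, mul_one, Real.norm_of_nonneg hR0.le]
    have h1 := (hCb (R • σ)).2.2
    have h2 := hcb (R • σ)
    rw [hnorm] at h1 h2
    have hp0 : 0 < p := by linarith
    have h3 : 1 / p * sobNormP N s p (comb N n (R • σ)) ≤ 1 / p * (C * R ^ p) := by gcongr
    have h4 : 1 / p * C * R ^ p < c * R ^ (q - p) * R ^ p :=
      mul_lt_mul_of_pos_right hR (by positivity)
    rw [mul_assoc c, ← Real.rpow_add hR0, sub_add_cancel] at h4
    change 1 / p * sobNormP N s p (comb N n (R • σ)) - _ < 0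
    linarith
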